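/- arXiv:2006.10372 — 2 statements merged into one kernel-verified Lean document; each statement's English description precedes it below -/
import Mathlib

section
/- Assume d = 1 (so H = ℓ²(ℕ), S the unilateral shift) and let Z be a weight operator such that S^p Z − Z S^p is compact for some p ≥ 1 (Condition A(p)). Let T be the smallest closed star-subalgebra of B(H) containing ZS. Then T/K is not simple: there exists a closed two-sided ideal I of T with K ⊊ I ⊊ T. -/
noncomputable section

/-- The Fock space of `ℂ` (the case `d = 1`), modeled as `ℓ²(ℕ)`. -/
abbrev FockSpace1 : Type := lp (fun _ : ℕ => ℂ) 2

/-- The standard basis vector `e_k` of `ℓ²(ℕ)`. -/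
noncomputable def e1 (k : ℕ) : FockSpace1 := lp.single 2 k (1 : ℂ)

namespace FockSpace1

open Filter Topology InnerProductSpace ContinuousLinearMap

local notation "H" => FockSpace1
local notation "𝓑" => FockSpace1 →L[ℂ] FockSpace1

section Basis

theorem inner_e1_left (k : ℕ) (v : H) : inner ℂ (e1 k) v = v k := by
  simp [e1, lp.inner_single_left]

theorem e1_apply (j k : ℕ) : e1 j k = if k = j then 1 else 0 := by
  rw [e1, lp.single_apply]
  split_ifs with h
  · subst h; exact Pi.single_eq_same k 1
  · simp [h]

theorem norm_e1 (k : ℕ) : ‖e1 k‖ = 1 := by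
  rw [e1, lp.norm_single (by norm_num)]; simp

theorem hasSum_smul_e1 (v : H) : HasSum (fun k => v k • e1 k) v := by
  have h := lp.hasSum_single (E := fun _ : ℕ => ℂ) (p := 2) (by norm_num) v
  convert h using 2 with k
  rw [e1, ← lp.single_smul]
  simp

theorem mem_of_forall_e1_mem {s : Submodule ℂ H} (hs : IsClosed (s : Set H))
    (h : ∀ k, e1 k ∈ s) (v : H) : v ∈ s :=
  hs.mem_of_tendsto (hasSum_smul_e1 v)
    (Eventually.of_forall fun _ => s.sum_mem fun k _ => s.smul_mem _ (h k))

theorem ext_e1 {F : Type*} [NormedAddCommGroup F] [NormedSpace ℂ F] {X Y : H →L[ℂ] F}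
    (h : ∀ k, X (e1 k) = Y (e1 k)) : X = Y := by
  ext1 v
  exact mem_of_forall_e1_mem (s := LinearMap.eqLocus X.toLinearMap Y.toLinearMap)
    (isClosed_eq X.continuous Y.continuous) h v

theorem apply_of_diagonal {D : 𝓑} {d : ℕ → ℂ} (hD : ∀ k, D (e1 k) = d k • e1 k) (v : H) (k : ℕ) :
    D v k = d k * v k := by
  have : (innerSL ℂ (e1 k)) ∘L D = d k • innerSL ℂ (e1 k) := by
    refine ext_e1 fun j => ?_
    simp only [comp_apply, innerSL_apply_apply, hD,
      _root_.smul_apply, inner_e1_left, lp.coeFn_smul, Pi.smul_apply, e1_apply,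
      smul_eq_mul]
    split_ifs with h <;> simp [h]
  simpa [inner_e1_left] using DFunLike.congr_fun this v

theorem norm_le_of_diagonal {D : 𝓑} {d : ℕ → ℂ} (hD : ∀ k, D (e1 k) = d k • e1 k) {C : ℝ}
    (hC : 0 ≤ C) (hd : ∀ k, ‖d k‖ ≤ C) : ‖D‖ ≤ C := by
  refine D.opNorm_le_bound hC fun v => ?_
  have : ‖D v‖ ≤ ‖(C : ℂ) • v‖ := by
    refine lp.norm_mono (by norm_num) fun k => ?_
    rw [apply_of_diagonal hD]
    simp only [lp.coeFn_smul, Pi.smul_apply, norm_smul, norm_mul, Complex.norm_real,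
      Real.norm_of_nonneg hC]
    gcongr
    exact hd k
  rwa [norm_smul, Complex.norm_real, Real.norm_of_nonneg hC] at this

/-- The orthogonal projection onto the span of the first `n` basis vectors. -/
def initialProj (n : ℕ) : 𝓑 := ∑ k ∈ Finset.range n, rankOne ℂ (e1 k) (e1 k)

theorem initialProj_e1 (n k : ℕ) : initialProj n (e1 k) = (if k < n then (1 : ℂ) else 0) • e1 k := by
  simp only [initialProj, _root_.sum_apply, rankOne_apply, inner_e1_left, e1_apply]
  split_ifs with h
  · rw [Finset.sum_eq_single_of_mem k (Finset.mem_range.2 h)]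
    · simp
    · intro j _ hj; simp [hj]
  · rw [zero_smul]
    refine Finset.sum_eq_zero fun j hj => ?_
    have : j ≠ k := by rintro rfl; exact h (Finset.mem_range.1 hj)
    simp [this]

theorem mul_initialProj (X : 𝓑) (n : ℕ) :
    X * initialProj n = ∑ k ∈ Finset.range n, rankOne ℂ (X (e1 k)) (e1 k) := by
  simp only [initialProj, Finset.mul_sum, mul_def, comp_rankOne]

end Basis

section WeaklyNull

/-- A bounded sequence converging weakly to zero. -/
structure WeaklyNull (v : ℕ → H) : Prop where
  bounded : ∃ C, ∀ n, ‖v n‖ ≤ C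
  tendsto_inner : ∀ u : H, Tendsto (fun n => inner ℂ u (v n)) atTop (𝓝 0)

theorem WeaklyNull.of_coord {v : ℕ → H} {C : ℝ} (hC : ∀ n, ‖v n‖ ≤ C)
    (h : ∀ k, Tendsto (fun n => v n k) atTop (𝓝 0)) : WeaklyNull v := by
  refine ⟨⟨C, hC⟩, fun u => ?_⟩
  have hC0 : 0 ≤ C := (norm_nonneg _).trans (hC 0)
  let s : Submodule ℂ H :=
    { carrier := {u | Tendsto (fun n => inner ℂ u (v n)) atTop (𝓝 0)}
      add_mem' := fun {a b} ha hb => by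
        simpa [inner_add_left] using Tendsto.add (Set.mem_ofPred.1 ha) (Set.mem_ofPred.1 hb)
      zero_mem' := by simp
      smul_mem' := fun c a ha => by
        simpa [inner_smul_left, mul_comm] using Tendsto.const_mul (starRingEnd ℂ c) (Set.mem_ofPred.1 ha) }
  refine mem_of_forall_e1_mem (s := s) ?_ (fun k => ?_) u
  · refine isClosed_of_closure_subset fun u hu => ?_
    refine Metric.tendsto_atTop.2 fun ε hε => ?_
    obtain ⟨a, ha, hua⟩ := Metric.mem_closure_iff.1 hu (ε / (2 * (C + 1))) (by positivity)
    obtain ⟨N, hN⟩ := Metric.tendsto_atTop.1 (Set.mem_ofPred.1 ha) (ε / 2) (by positivity)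
    refine ⟨N, fun n hn => ?_⟩
    have h1 := hN n hn
    rw [dist_zero_right] at h1 ⊢
    have h2 : ‖inner ℂ (u - a) (v n)‖ ≤ ε / (2 * (C + 1)) * (C + 1) := by
      refine (norm_inner_le_norm _ _).trans ?_
      rw [dist_eq_norm] at hua
      gcongr
      linarith [hC n]
    have h3 : ε / (2 * (C + 1)) * (C + 1) = ε / 2 := by field_simp
    have h4 : inner ℂ u (v n) = inner ℂ (u - a) (v n) + inner ℂ a (v n) := by
      rw [inner_sub_left]; ring
    rw [h4]
    linarith [norm_add_le (inner ℂ (u - a) (v n)) (inner ℂ a (v n))]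
  · change Tendsto (fun n => inner ℂ (e1 k) (v n)) atTop (𝓝 0)
    simpa only [inner_e1_left] using h k

theorem WeaklyNull.map {v : ℕ → H} (hv : WeaklyNull v) (X : 𝓑) :
    WeaklyNull fun n => X (v n) := by
  obtain ⟨C, hC⟩ := hv.bounded
  refine ⟨⟨‖X‖ * C, fun n => (X.le_opNorm _).trans (by gcongr; exact hC n)⟩, fun u => ?_⟩
  simpa only [adjoint_inner_left] using hv.tendsto_inner (adjoint X u)

theorem weaklyNull_e1 : WeaklyNull e1 := by
  refine .of_coord (C := 1) (fun n => (norm_e1 n).le) fun k => ?_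
  refine tendsto_const_nhds.congr' ?_
  filter_upwards [eventually_gt_atTop k] with n hn
  simp [e1_apply, hn.ne]

/-- An operator mapping weakly null sequences to norm null sequences. -/
def CompletelyContinuous (X : 𝓑) : Prop :=
  ∀ ⦃v : ℕ → H⦄, WeaklyNull v → Tendsto (fun n => X (v n)) atTop (𝓝 0)

namespace CompletelyContinuous

variable {X Y : 𝓑}

theorem add (hX : CompletelyContinuous X) (hY : CompletelyContinuous Y) :
    CompletelyContinuous (X + Y) := fun v hv => by
  simpa using Tendsto.add (hX hv) (hY hv)

theorem mul_left (hX : CompletelyContinuous X) (Y : 𝓑) : CompletelyContinuous (Y * X) :=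
  fun v hv => by
    simpa [Function.comp_def] using (Y.continuous.tendsto 0).comp (hX hv)

theorem mul_right (hX : CompletelyContinuous X) (Y : 𝓑) : CompletelyContinuous (X * Y) :=
  fun _ hv => hX (hv.map Y)

theorem zero : CompletelyContinuous 0 := fun v _ => by simp

theorem sum {ι : Type*} {s : Finset ι} {X : ι → 𝓑} (h : ∀ i ∈ s, CompletelyContinuous (X i)) :
    CompletelyContinuous (∑ i ∈ s, X i) :=
  Finset.sum_induction X CompletelyContinuous (fun _ _ => add) zero h

end CompletelyContinuous

theorem completelyContinuous_rankOne (x y : H) : CompletelyContinuous (rankOne ℂ x y) :=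
  fun v hv => by simpa using (hv.tendsto_inner y).smul_const x

theorem isClosed_tendsto_zero {v : ℕ → H} (hv : ∃ C, ∀ n, ‖v n‖ ≤ C) :
    IsClosed {X : 𝓑 | Tendsto (fun n => X (v n)) atTop (𝓝 0)} := by
  obtain ⟨C, hC⟩ := hv
  have hC0 : 0 ≤ C := (norm_nonneg _).trans (hC 0)
  refine isClosed_of_closure_subset fun X hX => Metric.tendsto_atTop.2 fun ε hε => ?_
  obtain ⟨Y, hY, hXY⟩ := Metric.mem_closure_iff.1 hX (ε / (2 * (C + 1))) (by positivity)
  obtain ⟨N, hN⟩ := Metric.tendsto_atTop.1 (Set.mem_ofPred.1 hY) (ε / 2) (by positivity)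
  refine ⟨N, fun n hn => ?_⟩
  have h1 := hN n hn
  rw [dist_zero_right] at h1 ⊢
  have h2 : ‖(X - Y) (v n)‖ ≤ ε / (2 * (C + 1)) * (C + 1) := by
    refine ((X - Y).le_opNorm _).trans ?_
    rw [dist_eq_norm] at hXY
    gcongr
    linarith [hC n]
  have h3 : ε / (2 * (C + 1)) * (C + 1) = ε / 2 := by field_simp
  have h4 : X (v n) = (X - Y) (v n) + Y (v n) := by simp
  rw [h4]
  linarith [norm_add_le ((X - Y) (v n)) (Y (v n))]

theorem isClosed_completelyContinuous : IsClosed {X : 𝓑 | CompletelyContinuous X} := by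
  have : {X : 𝓑 | CompletelyContinuous X} =
      ⋂ (v : ℕ → H) (_ : WeaklyNull v), {X : 𝓑 | Tendsto (fun n => X (v n)) atTop (𝓝 0)} := by
    ext X; simp [CompletelyContinuous]
  rw [this]
  exact isClosed_iInter fun v => isClosed_iInter fun hv => isClosed_tendsto_zero hv.bounded

theorem _root_.IsCompactOperator.completelyContinuous {X : 𝓑} (hX : IsCompactOperator X) :
    CompletelyContinuous X := fun v hv => by
  obtain ⟨C, hC⟩ := hv.bounded
  have hK := IsCompactOperator.isCompact_closure_image_closedBall (f := X.toLinearMap) hX C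
  refine tendsto_of_subseq_tendsto fun ns hns => ?_
  obtain ⟨y, -, φ, hφ, hy⟩ := hK.tendsto_subseq (x := fun n => X (v (ns n)))
    fun n => subset_closure ⟨v (ns n), by simpa using hC _, rfl⟩
  refine ⟨φ, ?_⟩
  have hy0 : y = 0 := by
    rw [← inner_self_eq_zero (𝕜 := ℂ)]
    exact tendsto_nhds_unique (tendsto_const_nhds.inner hy)
      (((hv.map X).tendsto_inner y).comp (hns.comp hφ.tendsto_atTop))
  exact hy0 ▸ hy

theorem completelyContinuous_of_diagonal {D : 𝓑} {d : ℕ → ℂ}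
    (hD : ∀ k, D (e1 k) = d k • e1 k) (hd : Tendsto d atTop (𝓝 0)) : CompletelyContinuous D := by
  refine isClosed_completelyContinuous.mem_of_tendsto (f := fun n => D * initialProj n)
    (b := atTop) ?_ (Eventually.of_forall fun n => ?_)
  · refine Metric.tendsto_atTop.2 fun ε hε => ?_
    obtain ⟨N, hN⟩ := Metric.tendsto_atTop.1 hd (ε / 2) (by positivity)
    refine ⟨N, fun n hn => ?_⟩
    rw [dist_eq_norm]
    refine (norm_le_of_diagonal (d := fun k => if k < n then 0 else - d k) (C := ε / 2)
      (fun k => ?_) (by positivity) fun k => ?_).trans_lt (by linarith)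
    · simp only [_root_.sub_apply, mul_apply_eq_comp, initialProj_e1, map_smul, hD]
      split_ifs <;> simp
    · split_ifs with h
      · simp only [norm_zero]; positivity
      · simpa using (hN k (by omega)).le
  · change CompletelyContinuous (D * initialProj n)
    rw [mul_initialProj]
    exact .sum fun k _ => completelyContinuous_rankOne _ _

theorem tendsto_mul_initialProj {X : 𝓑} (hX : CompletelyContinuous X) :
    Tendsto (fun n => X * initialProj n) atTop (𝓝 X) := by
  have hproj : ∀ n, ‖1 - initialProj n‖ ≤ 1 := fun n =>
    norm_le_of_diagonal (d := fun k => if k < n then 0 else 1)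
      (fun k => by
        simp only [_root_.sub_apply, initialProj_e1, one_apply_eq_self]
        split_ifs <;> simp)
      zero_le_one fun k => by split_ifs <;> simp
  have hcoord : ∀ n (v : H) k, (1 - initialProj n) v k = (if k < n then 0 else 1) * v k :=
    fun n v k => apply_of_diagonal (D := 1 - initialProj n)
      (d := fun k => if k < n then 0 else 1) (fun k => by
        simp only [_root_.sub_apply, initialProj_e1, one_apply_eq_self]
        split_ifs <;> simp) v k
  rw [tendsto_iff_norm_sub_tendsto_zero]
  have key : ∀ n : ℕ, ∃ u : H, ‖u‖ ≤ 1 ∧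
      ‖X - X * initialProj n‖ - 1 / ((n : ℝ) + 1) ≤ ‖X ((1 - initialProj n) u)‖ := fun n => by
    have hpos : (0 : ℝ) < 1 / ((n : ℝ) + 1) := by positivity
    rcases lt_or_ge (‖X - X * initialProj n‖ - 1 / ((n : ℝ) + 1)) 0 with h | h
    · exact ⟨0, by simp, by simpa using h.le⟩
    · lift ‖X - X * initialProj n‖ - 1 / ((n : ℝ) + 1) to NNReal using h with r hr
      obtain ⟨u, hu, hru⟩ := (X - X * initialProj n).exists_lt_apply_of_lt_opNorm
        (r := r) (by rw [hr]; linarith)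
      exact ⟨u, hu.le, by simpa using hru.le⟩
  choose u hu hX' using key
  have hnull : WeaklyNull fun n => (1 - initialProj n) (u n) := by
    refine .of_coord (C := 1) (fun n => ?_) fun k => ?_
    · calc _ ≤ ‖1 - initialProj n‖ * ‖u n‖ := le_opNorm _ _
        _ ≤ 1 * 1 := by gcongr; exacts [hproj n, hu n]
        _ = 1 := one_mul 1
    · refine tendsto_const_nhds.congr' ?_
      filter_upwards [eventually_gt_atTop k] with n hn
      simp only [hcoord, hn, if_true, zero_mul]
  have hlim := (hX hnull).norm.add tendsto_one_div_add_atTop_nhds_zero_nat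
  rw [norm_zero, add_zero] at hlim
  refine squeeze_zero (fun _ => norm_nonneg _) (fun n => ?_) hlim
  rw [norm_sub_rev]
  linarith [hX' n]

end WeaklyNull

section WeightedShift

variable {A S : 𝓑} {w : ℕ → ℂ}

theorem star_weightedShift_succ (hA : ∀ k, A (e1 k) = w k • e1 (k + 1)) (k : ℕ) :
    star A (e1 (k + 1)) = starRingEnd ℂ (w k) • e1 k := by
  ext j
  rw [← inner_e1_left, star_eq_adjoint, adjoint_inner_right, hA, inner_smul_left, inner_e1_left,
    lp.coeFn_smul, Pi.smul_apply, e1_apply, e1_apply, smul_eq_mul]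
  by_cases h : j = k <;> simp [h]

theorem star_weightedShift_zero (hA : ∀ k, A (e1 k) = w k • e1 (k + 1)) :
    star A (e1 0) = 0 := by
  ext j
  rw [← inner_e1_left, star_eq_adjoint, adjoint_inner_right, hA, inner_smul_left, inner_e1_left,
    e1_apply]
  simp

theorem weightedShift_pow (hA : ∀ k, A (e1 k) = w k • e1 (k + 1)) (n k : ℕ) :
    (A ^ n) (e1 k) = (∏ i ∈ Finset.range n, w (k + i)) • e1 (k + n) := by
  induction n with
  | zero => simp
  | succ n ih =>
    rw [pow_succ', mul_apply_eq_comp, ih, map_smul, hA, smul_smul, Finset.prod_range_succ,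
      add_assoc]

theorem rankOne_zero_mem (hA : ∀ k, A (e1 k) = w k • e1 (k + 1)) {δ M : ℝ} (hδ : 0 < δ)
    (hw : ∀ k, δ ≤ ‖w k‖) (hwM : ∀ k, ‖w k‖ ≤ M) {T : StarSubalgebra ℂ 𝓑}
    (hT : IsClosed (T : Set 𝓑)) (hAT : A ∈ T) : rankOne ℂ (e1 0) (e1 0) ∈ T := by
  have hM : 0 < M := hδ.trans_le ((hw 0).trans (hwM 0))
  set R : 𝓑 := 1 - ((M ^ 2)⁻¹ : ℂ) • (A * star A) with hR
  have hRT : R ∈ T := T.sub_mem T.one_mem (T.smul_mem (mul_mem hAT (star_mem hAT)) _)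
  set ρ : ℕ → ℝ := fun k => 1 - (M ^ 2)⁻¹ * ‖w k‖ ^ 2 with hρ
  have hR0 : R (e1 0) = e1 0 := by
    simp [hR, star_weightedShift_zero hA]
  have hRs : ∀ k, R (e1 (k + 1)) = (ρ k : ℂ) • e1 (k + 1) := fun k => by
    rw [hR, _root_.sub_apply, _root_.smul_apply, mul_apply_eq_comp, star_weightedShift_succ hA,
      map_smul, hA, smul_smul, smul_smul, one_apply_eq_self, mul_assoc, Complex.conj_mul']
    simp only [hρ]
    push_cast
    rw [sub_smul, one_smul]
  have hRn0 : ∀ n, (R ^ n) (e1 0) = e1 0 := fun n => by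
    induction n with
    | zero => simp
    | succ n ih => rw [pow_succ, mul_apply_eq_comp, hR0, ih]
  have hRns : ∀ n k, (R ^ n) (e1 (k + 1)) = ((ρ k ^ n : ℝ) : ℂ) • e1 (k + 1) := fun n k => by
    induction n with
    | zero => simp
    | succ n ih =>
      rw [pow_succ, mul_apply_eq_comp, hRs, map_smul, ih, smul_smul]
      push_cast
      ring_nf
  set q : ℝ := 1 - (M ^ 2)⁻¹ * δ ^ 2 with hq
  have hM2 : (M ^ 2)⁻¹ * M ^ 2 = 1 := by field_simp
  have hρ0 : ∀ k, 0 ≤ ρ k := fun k => by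
    have : (M ^ 2)⁻¹ * ‖w k‖ ^ 2 ≤ (M ^ 2)⁻¹ * M ^ 2 := by gcongr; exact hwM k
    simp only [hρ]; linarith
  have hρq : ∀ k, ρ k ≤ q := fun k => by
    have : (M ^ 2)⁻¹ * δ ^ 2 ≤ (M ^ 2)⁻¹ * ‖w k‖ ^ 2 := by gcongr; exact hw k
    simp only [hρ, hq]; linarith
  have hq0 : 0 ≤ q := (hρ0 0).trans (hρq 0)
  have hq1 : q < 1 := by
    have : 0 < (M ^ 2)⁻¹ * δ ^ 2 := by positivity
    simp only [hq]; linarith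
  have hbound : ∀ n, ‖R ^ n - rankOne ℂ (e1 0) (e1 0)‖ ≤ q ^ n := fun n => by
    refine norm_le_of_diagonal
      (d := fun k => if k = 0 then 0 else ((ρ (k - 1) ^ n : ℝ) : ℂ)) (fun k => ?_)
      (by positivity) fun k => ?_
    · rcases k with - | k
      · simp [hRn0, norm_e1]
      · simp [hRns, inner_e1_left, e1_apply]
    · rcases k with - | k
      · simp only [if_true, norm_zero]; positivity
      · simp only [Nat.add_one_ne_zero, if_false, Nat.add_sub_cancel, Complex.norm_real,
          Real.norm_of_nonneg (pow_nonneg (hρ0 k) n)]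
        exact pow_le_pow_left₀ (hρ0 k) (hρq k) n
  refine hT.mem_of_tendsto (f := fun n => R ^ n) (b := atTop) ?_
    (Eventually.of_forall fun n => T.pow_mem hRT n)
  rw [tendsto_iff_norm_sub_tendsto_zero]
  exact squeeze_zero (fun _ => norm_nonneg _) hbound (tendsto_pow_atTop_nhds_zero_of_lt_one hq0 hq1)

theorem CompletelyContinuous.mem (hA : ∀ k, A (e1 k) = w k • e1 (k + 1)) {δ M : ℝ} (hδ : 0 < δ)
    (hw : ∀ k, δ ≤ ‖w k‖) (hwM : ∀ k, ‖w k‖ ≤ M) {T : StarSubalgebra ℂ 𝓑}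
    (hT : IsClosed (T : Set 𝓑)) (hAT : A ∈ T) {X : 𝓑} (hX : CompletelyContinuous X) : X ∈ T := by
  have hw0 : ∀ k, w k ≠ 0 := fun k => norm_pos_iff.1 (hδ.trans_le (hw k))
  have hc0 : ∀ n, ∏ i ∈ Finset.range n, w (0 + i) ≠ 0 := fun n =>
    Finset.prod_ne_zero_iff.2 fun i _ => hw0 _
  have hunit : ∀ i j, rankOne ℂ (e1 i) (e1 j) ∈ T := fun i j => by
    have h : A ^ i * rankOne ℂ (e1 0) (e1 0) * star (A ^ j) ∈ T :=
      mul_mem (mul_mem (T.pow_mem hAT i) (rankOne_zero_mem hA hδ hw hwM hT hAT))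
        (star_mem (T.pow_mem hAT j))
    have heq : A ^ i * rankOne ℂ (e1 0) (e1 0) * star (A ^ j) =
        ((∏ k ∈ Finset.range i, w (0 + k)) * starRingEnd ℂ (∏ k ∈ Finset.range j, w (0 + k))) •
          rankOne ℂ (e1 i) (e1 j) := by
      rw [mul_def, mul_def, comp_rankOne, rankOne_comp, star_eq_adjoint, adjoint_adjoint,
        weightedShift_pow hA, weightedShift_pow hA, zero_add, zero_add]
      ext1 v
      rw [_root_.smul_apply, rankOne_apply, rankOne_apply, inner_smul_left, smul_smul, smul_smul]
      ring_nf
    rw [heq] at h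
    refine (Submodule.smul_mem_iff T.toSubalgebra.toSubmodule (mul_ne_zero (hc0 i) ?_)).1 h
    exact (map_ne_zero _).2 (hc0 j)
  have hcol : ∀ (x : H) j, rankOne ℂ x (e1 j) ∈ T := fun x j =>
    mem_of_forall_e1_mem
      (s := T.toSubalgebra.toSubmodule.comap
        ((rankOne ℂ : H →L[ℂ] H →L⋆[ℂ] 𝓑).flip (e1 j)).toLinearMap)
      (hT.preimage ((rankOne ℂ : H →L[ℂ] H →L⋆[ℂ] 𝓑).flip (e1 j)).continuous)
      (fun i => hunit i j) x
  refine hT.mem_of_tendsto (tendsto_mul_initialProj hX) (Eventually.of_forall fun n => ?_)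
  rw [mul_initialProj]
  exact T.sum_mem fun k _ => hcol _ k

theorem pow_commutator_star (hA : ∀ k, A (e1 k) = w k • e1 (k + 1))
    (hS : ∀ k, S (e1 k) = e1 (k + 1)) {p : ℕ} {d : ℕ → ℂ}
    (hd : ∀ k, d k = (∏ i ∈ Finset.range p, w (k + i)) * starRingEnd ℂ (w k) -
      starRingEnd ℂ (w (k + p)) * ∏ i ∈ Finset.range p, w (k + 1 + i))
    (hd0 : Tendsto d atTop (𝓝 0)) :
    CompletelyContinuous (A ^ p * star A - star A * A ^ p) := by
  have hS1 : ∀ k, S (e1 k) = (fun _ => (1 : ℂ)) k • e1 (k + 1) := by simpa using hS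
  have hSp : ∀ n k, (S ^ n) (e1 k) = e1 (k + n) := fun n k => by
    simpa using weightedShift_pow hS1 n k
  set X := A ^ p * star A - star A * A ^ p with hX
  have hXS : ∀ k, X (e1 (k + 1)) = d k • e1 (k + p) := fun k => by
    rw [hX, _root_.sub_apply, mul_apply_eq_comp, mul_apply_eq_comp, star_weightedShift_succ hA,
      map_smul, weightedShift_pow hA, weightedShift_pow hA, map_smul,
      show k + 1 + p = k + p + 1 by ring, star_weightedShift_succ hA, smul_smul, smul_smul,
      ← sub_smul, hd]
    ring_nf
  have hSpS : star (S ^ p) * S ^ p = 1 := by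
    refine ext_e1 fun k => ?_
    ext j
    rw [← inner_e1_left, mul_apply_eq_comp, star_eq_adjoint, adjoint_inner_right, hSp, hSp,
      inner_e1_left, one_apply_eq_self, e1_apply, e1_apply]
    simp
  have hD : ∀ k, (star (S ^ p) * X * S) (e1 k) = d k • e1 k := fun k => by
    rw [mul_apply_eq_comp, mul_apply_eq_comp, hS, hXS, map_smul, ← hSp, ← mul_apply_eq_comp, hSpS,
      one_apply_eq_self]
  have key : X = S ^ p * (star (S ^ p) * X * S) * star S + rankOne ℂ (X (e1 0)) (e1 0) := by
    refine ext_e1 fun k => ?_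
    rcases k with - | k
    · simp [star_weightedShift_zero hS1, norm_e1]
    · rw [_root_.add_apply, mul_apply_eq_comp, star_weightedShift_succ hS1, rankOne_apply,
        inner_e1_left, e1_apply]
      simp only [map_one, one_smul]
      rw [mul_apply_eq_comp, hD, map_smul, hSp, hXS]
      simp
  rw [key]
  exact (((completelyContinuous_of_diagonal hD hd0).mul_left _).mul_right _).add
    (completelyContinuous_rankOne _ _)

theorem commutator_of_mem_elemental {B : 𝓑} (hBA : B * A = A * B)
    (hB : CompletelyContinuous (B * star A - star A * B)) {t : 𝓑}
    (ht : t ∈ StarAlgebra.elemental ℂ A) : CompletelyContinuous (B * t - t * B) := by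
  have hcl : IsClosed {t : 𝓑 | CompletelyContinuous (B * t - t * B)} :=
    isClosed_completelyContinuous.preimage
      (f := fun t => B * t - t * B) (by fun_prop)
  have : ∀ t ∈ StarAlgebra.adjoin ℂ {A}, CompletelyContinuous (B * t - t * B) := fun t ht => by
    have hmem : t ∈ Algebra.adjoin ℂ ({A} ∪ star {A} : Set 𝓑) := ht
    induction hmem using Algebra.adjoin_induction with
    | mem x hx =>
      rcases hx with hx | hx
      · rw [Set.mem_singleton_iff.1 hx, hBA, sub_self]
        exact .zero
      · rw [Set.star_singleton] at hx
        rw [Set.mem_singleton_iff.1 hx]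
        exact hB
    | algebraMap r =>
      rw [Algebra.commutes, sub_self]
      exact .zero
    | add x y hx hy ihx ihy =>
      have : B * (x + y) - (x + y) * B = (B * x - x * B) + (B * y - y * B) := by noncomm_ring
      rw [this]
      exact (ihx hx).add (ihy hy)
    | mul x y hx hy ihx ihy =>
      have : B * (x * y) - x * y * B = (B * x - x * B) * y + x * (B * y - y * B) := by noncomm_ring
      rw [this]
      exact ((ihx hx).mul_right y).add ((ihy hy).mul_left x)
  exact closure_minimal this hcl ht

end WeightedShift

section ApproximateEigenvectors

theorem orthonormal_e1 : Orthonormal ℂ e1 :=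
  orthonormal_iff_ite.2 fun i j => by rw [inner_e1_left, e1_apply]

/-- Normalized sum of `n` basis vectors, starting at `k` with step `p`. -/
def blockVector (p k n : ℕ) : H :=
  ((Real.sqrt n)⁻¹ : ℂ) • ∑ j ∈ Finset.range n, e1 (k + j * p)

theorem norm_blockVector {p n : ℕ} (hp : 0 < p) (hn : 0 < n) (k : ℕ) :
    ‖blockVector p k n‖ = 1 := by
  have horth : Orthonormal ℂ fun j => e1 (k + j * p) :=
    orthonormal_e1.comp _ fun i j hij => by
      have : i * p = j * p := by simpa using hij
      exact Nat.eq_of_mul_eq_mul_right hp this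
  have hsum : ‖∑ j ∈ Finset.range n, e1 (k + j * p)‖ = Real.sqrt n := by
    rw [norm_eq_sqrt_re_inner (𝕜 := ℂ)]
    have := horth.inner_sum (fun _ => (1 : ℂ)) (fun _ => 1) (Finset.range n)
    simp only [one_smul] at this
    rw [this]
    simp
  have hn' : Real.sqrt n ≠ 0 := by positivity
  rw [blockVector, norm_smul, hsum, norm_inv, Complex.norm_real,
    Real.norm_of_nonneg (Real.sqrt_nonneg _), inv_mul_cancel₀ hn']

theorem blockVector_apply_of_lt {p k n i : ℕ} (h : i < k) : blockVector p k n i = 0 := by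
  rw [← inner_e1_left, blockVector, inner_smul_right, inner_sum]
  simp only [inner_e1_left, e1_apply]
  rw [Finset.sum_eq_zero fun j _ => if_neg (by omega), mul_zero]

theorem norm_apply_blockVector_sub_le {B : 𝓑} {c : ℕ → ℂ} {p k n : ℕ}
    (hB : ∀ k, B (e1 k) = c k • e1 (k + p)) (μ : ℂ) (hn : 0 < n)
    (hc : ∀ j < n, ‖c (k + j * p) - μ‖ ≤ (n : ℝ)⁻¹) :
    ‖B (blockVector p k n) - μ • blockVector p k n‖ ≤ (Real.sqrt n)⁻¹ * (1 + 2 * ‖μ‖) := by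
  have hsplit : B (blockVector p k n) - μ • blockVector p k n = ((Real.sqrt n)⁻¹ : ℂ) •
      ((∑ j ∈ Finset.range n, (c (k + j * p) - μ) • e1 (k + (j + 1) * p)) +
        μ • (e1 (k + n * p) - e1 (k + 0 * p))) := by
    rw [← Finset.sum_range_sub (fun j => e1 (k + j * p)), blockVector, map_smul, map_sum,
      smul_comm μ, ← smul_sub, Finset.smul_sum, Finset.smul_sum, ← Finset.sum_sub_distrib,
      ← Finset.sum_add_distrib]
    congr 1
    refine Finset.sum_congr rfl fun j _ => ?_
    rw [hB, show k + j * p + p = k + (j + 1) * p by ring, sub_smul, smul_sub]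
    abel
  have h1 : ‖∑ j ∈ Finset.range n, (c (k + j * p) - μ) • e1 (k + (j + 1) * p)‖ ≤ 1 := by
    refine (norm_sum_le_of_le (f := fun j => (c (k + j * p) - μ) • e1 (k + (j + 1) * p)) _
      (n := fun _ => (n : ℝ)⁻¹) fun j hj => ?_).trans ?_
    · rw [norm_smul, norm_e1, mul_one]
      exact hc j (Finset.mem_range.1 hj)
    · have : (n : ℝ) ≠ 0 := by positivity
      simp [this]
  have h2 : ‖e1 (k + n * p) - e1 (k + 0 * p)‖ ≤ 2 := by
    refine (norm_sub_le _ _).trans ?_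
    rw [norm_e1, norm_e1]; norm_num
  rw [hsplit, norm_smul, norm_inv, Complex.norm_real, Real.norm_of_nonneg (Real.sqrt_nonneg _)]
  gcongr
  refine (norm_add_le _ _).trans ?_
  rw [norm_smul]
  nlinarith [norm_nonneg μ]

theorem tendsto_shift_sub_zero {c : ℕ → ℂ}
    (hc : Tendsto (fun k => c (k + 1) - c k) atTop (𝓝 0)) (i : ℕ) :
    Tendsto (fun k => c (k + i) - c k) atTop (𝓝 0) := by
  induction i with
  | zero => simp
  | succ i ih =>
    simpa [add_assoc] using (hc.comp (tendsto_add_atTop_nat i)).add ih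

theorem exists_approximate_eigenvectors {B : 𝓑} {c : ℕ → ℂ} {p : ℕ} (hp : 0 < p)
    (hB : ∀ k, B (e1 k) = c k • e1 (k + p))
    (hc : Tendsto (fun k => c (k + 1) - c k) atTop (𝓝 0)) :
    ∃ (μ : ℂ) (v : ℕ → H), WeaklyNull v ∧ (∀ n, ‖v n‖ = 1) ∧
      Tendsto (fun n => B (v n) - μ • v n) atTop (𝓝 0) := by
  have hbdd : ∀ k, c k ∈ Metric.closedBall (0 : ℂ) ‖B‖ := fun k => by
    have := B.le_opNorm (e1 k)
    simpa [hB, norm_smul, norm_e1] using this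
  obtain ⟨μ, -, φ, hφ, hμ⟩ := tendsto_subseq_of_bounded Metric.isBounded_closedBall hbdd
  have hshift : ∀ i, Tendsto (fun n => c (φ n + i)) atTop (𝓝 μ) := fun i => by
    simpa [Function.comp_def] using ((tendsto_shift_sub_zero hc i).comp hφ.tendsto_atTop).add hμ
  have hchoice : ∀ n : ℕ, ∃ k ≥ n, ∀ j < n + 1, ‖c (k + j * p) - μ‖ ≤ ((n + 1 : ℕ) : ℝ)⁻¹ :=
      fun n => by
    have h1 : ∀ᶠ m in atTop, ∀ j ∈ Finset.range (n + 1),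
        ‖c (φ m + j * p) - μ‖ ≤ ((n + 1 : ℕ) : ℝ)⁻¹ := by
      rw [Filter.eventually_all_finset]
      intro j _
      have := (tendsto_iff_norm_sub_tendsto_zero.1 (hshift (j * p))).eventually_le_const
        (show (0 : ℝ) < ((n + 1 : ℕ) : ℝ)⁻¹ by positivity)
      exact this
    obtain ⟨m, hm, hmn⟩ := (h1.and (hφ.tendsto_atTop.eventually_ge_atTop n)).exists
    exact ⟨φ m, hmn, fun j hj => hm j (Finset.mem_range.2 hj)⟩
  choose k hk hck using hchoice
  have hnorm : ∀ n, ‖blockVector p (k n) (n + 1)‖ = 1 := fun n =>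
    norm_blockVector hp n.succ_pos _
  refine ⟨μ, fun n => blockVector p (k n) (n + 1),
    .of_coord (fun n => (hnorm n).le) fun i => tendsto_const_nhds.congr' ?_, hnorm, ?_⟩
  · filter_upwards [eventually_gt_atTop i] with n hn
    exact (blockVector_apply_of_lt (hn.trans_le (hk n))).symm
  · rw [tendsto_zero_iff_norm_tendsto_zero]
    refine squeeze_zero (fun _ => norm_nonneg _)
      (fun n => norm_apply_blockVector_sub_le hB μ n.succ_pos (hck n)) ?_
    have h := (tendsto_inv_atTop_zero.comp (Real.tendsto_sqrt_atTop.comp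
      (tendsto_natCast_atTop_atTop.comp (tendsto_add_atTop_nat 1)))).mul_const (1 + 2 * ‖μ‖)
    simpa [Function.comp_def] using h

end ApproximateEigenvectors

theorem exists_intermediate_ideal {A S : 𝓑} {w : ℕ → ℂ} {δ : ℝ} {p : ℕ}
    (hA : ∀ k, A (e1 k) = w k • e1 (k + 1)) (hS : ∀ k, S (e1 k) = e1 (k + 1))
    (hδ : 0 < δ) (hw : ∀ k, δ ≤ ‖w k‖) (hp : 0 < p)
    (hwp : Tendsto (fun k => w (k + p) - w k) atTop (𝓝 0)) {T : StarSubalgebra ℂ 𝓑}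
    (hT : T = StarAlgebra.elemental ℂ A) :
    ∃ I ⊆ (T : Set 𝓑), IsClosed I ∧ 0 ∈ I ∧ (∀ x ∈ I, ∀ y ∈ I, x + y ∈ I) ∧
      (∀ t ∈ T, ∀ x ∈ I, t * x ∈ I ∧ x * t ∈ I) ∧ {X : 𝓑 | IsCompactOperator X} ⊆ I ∧
      I ≠ {X : 𝓑 | IsCompactOperator X} ∧ I ≠ (T : Set 𝓑) := by
  have hTcl : IsClosed (T : Set 𝓑) := hT ▸ StarAlgebra.elemental.isClosed ℂ A
  have hAT : A ∈ T := hT ▸ StarAlgebra.elemental.self_mem ℂ A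
  set c : ℕ → ℂ := fun k => ∏ i ∈ Finset.range p, w (k + i) with hcdef
  have hB : ∀ k, (A ^ p) (e1 k) = c k • e1 (k + p) := weightedShift_pow hA p
  have hcB : ∀ k, ‖c k‖ ≤ ‖A ^ p‖ := fun k => by
    have := (A ^ p).le_opNorm (e1 k)
    rwa [hB, norm_smul, norm_e1, norm_e1, mul_one, mul_one] at this
  have hwM : ∀ k, ‖w k‖ ≤ ‖A‖ := fun k => by
    have := A.le_opNorm (e1 k)
    rwa [hA, norm_smul, norm_e1, norm_e1, mul_one, mul_one] at this
  have hcs : ∀ k, (c (k + 1) - c k) * w k = c k * (w (k + p) - w k) := fun k => by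
    have h1 := Finset.prod_range_succ (fun i => w (k + i)) p
    rw [Finset.prod_range_succ'] at h1
    have h2 : c (k + 1) * w k = c k * w (k + p) := by
      simpa [hcdef, add_assoc, add_comm 1] using h1
    rw [sub_mul, h2]
    ring
  have hc : Tendsto (fun k => c (k + 1) - c k) atTop (𝓝 0) := by
    rw [tendsto_zero_iff_norm_tendsto_zero]
    have hlim := (tendsto_zero_iff_norm_tendsto_zero.1 hwp).const_mul (‖A ^ p‖ / δ)
    rw [mul_zero] at hlim
    refine squeeze_zero (fun _ => norm_nonneg _) (fun k => ?_) hlim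
    rw [div_mul_eq_mul_div, le_div_iff₀ hδ]
    calc ‖c (k + 1) - c k‖ * δ ≤ ‖c (k + 1) - c k‖ * ‖w k‖ := by gcongr; exact hw k
      _ = ‖c k‖ * ‖w (k + p) - w k‖ := by rw [← norm_mul, hcs, norm_mul]
      _ ≤ ‖A ^ p‖ * ‖w (k + p) - w k‖ := by gcongr; exact hcB k
  have hd : Tendsto (fun k => c k * starRingEnd ℂ (w k) - starRingEnd ℂ (w (k + p)) * c (k + 1))
      atTop (𝓝 0) := by
    rw [tendsto_zero_iff_norm_tendsto_zero] at hc hwp ⊢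
    have hlim := (hc.const_mul ‖A‖).add (hwp.const_mul ‖A ^ p‖)
    rw [mul_zero, mul_zero, add_zero] at hlim
    refine squeeze_zero (fun _ => norm_nonneg _) (fun k => ?_) hlim
    have : c k * starRingEnd ℂ (w k) - starRingEnd ℂ (w (k + p)) * c (k + 1) =
        -(starRingEnd ℂ (w (k + p)) * (c (k + 1) - c k)) -
          c k * starRingEnd ℂ (w (k + p) - w k) := by
      rw [map_sub]; ring
    rw [this]
    refine (norm_sub_le _ _).trans ?_
    rw [norm_neg, norm_mul, norm_mul, RCLike.norm_conj, RCLike.norm_conj]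
    gcongr
    exacts [hwM _, hcB k]
  have hcomm : ∀ t ∈ T, CompletelyContinuous (A ^ p * t - t * A ^ p) := fun t ht =>
    commutator_of_mem_elemental (by rw [← pow_succ, ← pow_succ'])
      (pow_commutator_star hA hS (fun _ => rfl) hd) (hT ▸ ht)
  obtain ⟨μ, v, hv, hv1, hμ⟩ := exists_approximate_eigenvectors hp hB hc
  refine ⟨{x | x ∈ T ∧ ∀ t ∈ T, Tendsto (fun n => (x * t) (v n)) atTop (𝓝 0)},
    fun x hx => hx.1, ?_, ⟨T.zero_mem, by simp⟩, ?_, ?_, ?_, ?_, ?_⟩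
  · have : {x : 𝓑 | x ∈ T ∧ ∀ t ∈ T, Tendsto (fun n => (x * t) (v n)) atTop (𝓝 0)} =
        (T : Set 𝓑) ∩ ⋂ t ∈ T, {x : 𝓑 | Tendsto (fun n => (x * t) (v n)) atTop (𝓝 0)} := by
      ext x; simp
    rw [this]
    exact hTcl.inter (isClosed_biInter fun t _ =>
      (isClosed_tendsto_zero hv.bounded).preimage (f := fun x => x * t) (by fun_prop))
  · rintro x ⟨hx, hx'⟩ y ⟨hy, hy'⟩
    exact ⟨T.add_mem hx hy, fun t ht => by simpa using (hx' t ht).add (hy' t ht)⟩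
  · rintro s hs x ⟨hx, hx'⟩
    refine ⟨⟨T.mul_mem hs hx, fun t ht => ?_⟩, ⟨T.mul_mem hx hs, fun t ht => ?_⟩⟩
    · simpa [Function.comp_def] using (s.continuous.tendsto 0).comp (hx' t ht)
    · rw [mul_assoc]; exact hx' _ (T.mul_mem hs ht)
  · intro X hX
    have hX' := IsCompactOperator.completelyContinuous hX
    exact ⟨hX'.mem hA hδ hw hwM hTcl hAT, fun t _ => hX'.mul_right t hv⟩
  · intro heq
    have hmem : A ^ p - μ • 1 ∈ {X : 𝓑 | IsCompactOperator X} := by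
      rw [← heq]
      refine ⟨T.sub_mem (T.pow_mem hAT p) (T.smul_mem T.one_mem μ), fun t ht => ?_⟩
      have h := ((t.continuous.tendsto 0).comp hμ).add (hcomm t ht hv)
      rw [map_zero, add_zero] at h
      refine h.congr fun n => ?_
      simp [sub_mul]
    have hlim := (IsCompactOperator.completelyContinuous hmem) weaklyNull_e1
    have hge : ∀ k, δ ^ p ≤ ‖(A ^ p - μ • 1) (e1 k)‖ := fun k => by
      have h1 := lp.norm_apply_le_norm (E := fun _ : ℕ => ℂ) (p := 2) (by norm_num)
        ((A ^ p - μ • 1 : 𝓑) (e1 k)) (k + p)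
      have h2 : (A ^ p - μ • 1 : 𝓑) (e1 k) (k + p) = c k := by
        rw [_root_.sub_apply, hB, _root_.smul_apply, one_apply_eq_self, lp.coeFn_sub,
          Pi.sub_apply, lp.coeFn_smul, lp.coeFn_smul, Pi.smul_apply, Pi.smul_apply, e1_apply,
          e1_apply]
        simp [hp.ne']
      rw [h2] at h1
      refine le_trans ?_ h1
      rw [hcdef, norm_prod]
      simpa using Finset.prod_le_prod (s := Finset.range p) (f := fun _ => δ)
        (g := fun i => ‖w (k + i)‖) (fun _ _ => hδ.le) fun i _ => hw _
    have := ge_of_tendsto' hlim.norm hge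
    rw [norm_zero] at this
    exact absurd this (not_le.2 (by positivity))
  · intro heq
    have h1 : (1 : 𝓑) ∈ (T : Set 𝓑) := T.one_mem
    rw [← heq] at h1
    have h2 := (h1.2 1 T.one_mem).norm
    simp [hv1] at h2

end FockSpace1

open ContinuousLinearMap in
theorem statement15
    (S : FockSpace1 →L[ℂ] FockSpace1)
    (hS : ∀ k : ℕ, S (e1 k) = e1 (k + 1))
    (P : ℕ → (FockSpace1 →L[ℂ] FockSpace1))
    (hP : ∀ k m : ℕ, P k (e1 m) = if m = k then e1 m else 0)
    (Z : FockSpace1 →L[ℂ] FockSpace1)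
    (hZinv : IsUnit Z)
    (hZP : ∀ k : ℕ, Z * P k = P k * Z)
    (hZ0 : Z * P 0 = P 0)
    (p : ℕ) (hp : 1 ≤ p)
    (hAp : IsCompactOperator ⇑(S ^ p * Z - Z * S ^ p))
    (T : StarSubalgebra ℂ (FockSpace1 →L[ℂ] FockSpace1))
    (hT : T = (StarAlgebra.adjoin ℂ ({Z * S} : Set (FockSpace1 →L[ℂ] FockSpace1))).topologicalClosure)
    (K : Set (FockSpace1 →L[ℂ] FockSpace1))
    (hK : K = {Y : FockSpace1 →L[ℂ] FockSpace1 | IsCompactOperator ⇑Y}) :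
    ∃ I : Set (FockSpace1 →L[ℂ] FockSpace1),
      I ⊆ (T : Set (FockSpace1 →L[ℂ] FockSpace1)) ∧ IsClosed I ∧ (0 : _) ∈ I ∧
      (∀ x ∈ I, ∀ y ∈ I, x + y ∈ I) ∧
      (∀ t ∈ T, ∀ x ∈ I, t * x ∈ I ∧ x * t ∈ I) ∧
      K ⊆ I ∧ I ≠ K ∧ I ≠ (T : Set (FockSpace1 →L[ℂ] FockSpace1)) := by
  open FockSpace1 in
  have hZe : ∀ k, ∃ z : ℂ, Z (e1 k) = z • e1 k := fun k => by
    have hPk : P k = InnerProductSpace.rankOne ℂ (e1 k) (e1 k) := ext_e1 fun m => by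
      rw [hP, InnerProductSpace.rankOne_apply, inner_e1_left, e1_apply]
      by_cases h : m = k
      · simp [h]
      · simp [h, Ne.symm h]
    have h := DFunLike.congr_fun (hZP k) (e1 k)
    rw [mul_apply_eq_comp, mul_apply_eq_comp, hP, if_pos rfl, hPk,
      InnerProductSpace.rankOne_apply] at h
    exact ⟨_, h⟩
  choose z hz using hZe
  obtain ⟨Y, hYZ⟩ := hZinv.exists_left_inv
  have hlow : ∀ k, 1 ≤ ‖Y‖ * ‖z k‖ := fun k => by
    have h := Y.le_opNorm (Z (e1 k))
    rwa [← mul_apply_eq_comp, hYZ, one_apply_eq_self, hz, norm_smul, norm_e1, mul_one] at h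
  have hY : 0 < ‖Y‖ := by
    by_contra! h
    nlinarith [hlow 0, norm_nonneg (z 0)]
  have hSp : ∀ k, (S ^ p) (e1 k) = e1 (k + p) := fun k => by
    simpa using weightedShift_pow (w := fun _ => 1) (by simpa using hS) p k
  have hwp : Filter.Tendsto (fun k => z (k + p) - z k) Filter.atTop (nhds 0) := by
    have h := (IsCompactOperator.completelyContinuous hAp weaklyNull_e1).norm
    rw [norm_zero] at h
    rw [tendsto_zero_iff_norm_tendsto_zero]
    refine h.congr fun k => ?_
    rw [_root_.sub_apply, mul_apply_eq_comp, mul_apply_eq_comp, hz, map_smul, hSp, hz, ← sub_smul,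
      norm_smul, norm_e1, mul_one, norm_sub_rev]
  rw [hK]
  refine exists_intermediate_ideal (w := fun k => z (k + 1)) (δ := ‖Y‖⁻¹) (fun k => ?_) hS
    (inv_pos.2 hY) (fun k => (inv_le_iff_one_le_mul₀' hY).2 (hlow _)) hp ?_ hT
  · rw [mul_apply_eq_comp, hS, hz]
  · simpa [Function.comp_def, add_right_comm] using hwp.comp (Filter.tendsto_add_atTop_nat 1)
end
end

section
/- Let d = 2, fix N ≥ 1 and positive invertible matrices A, B ∈ M_{2^N}(ℂ). Let Z be the weight operator whose block Z_k on the span of words of length k is: the identity for k < N, and for k ≥ N, Z_k = I_{2^{k−N}} ⊗ A if k − N is even and Z_k = I_{2^{k−N}} ⊗ B if k − N is odd (under the identification of the level-k space with ℂ^{2^{k−N}} ⊗ ℂ^{2^N} via splitting a word into its first k − N letters and its last N letters). Then for every element f of the free unital ℂ-algebra on three noncommuting generators x, y, w having zero constant term, the following are equivalent: (1) f(A, B, I_{2^N}) = 0 and f(B, A, I_{2^N}) = 0 in M_{2^N}(ℂ); (2) f(S_1 S_1* Z, S_1 Z S_1*, S_1 S_1*) is a compact operator on H; (3) f(S_1 Z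 S_1*, S_1 S_1* Z, S_1 S_1*) is a compact operator on H. -/
noncomputable section

instance (α : Type*) [DecidableEq α] : DecidableEq (FreeMonoid α) :=
  fun a b => inferInstanceAs (Decidable (a.toList = b.toList))

/-- The full Fock space of `ℂ^d`, modeled as `ℓ²` of the free monoid on `Fin d`. -/
abbrev FockSpace (d : ℕ) : Type := lp (fun _ : FreeMonoid (Fin d) => ℂ) 2

/-- The standard basis vector `e_α` of the Fock space. -/
noncomputable def fockBasis (d : ℕ) (α : FreeMonoid (Fin d)) : FockSpace d :=
  lp.single 2 α (1 : ℂ)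

/-- `S_α = S_{α₁} ⋯ S_{αₙ}` for a word `α` (with `S_∅ = 1`). -/
noncomputable def wordOp {d : ℕ} (S : Fin d → (FockSpace d →L[ℂ] FockSpace d))
    (α : FreeMonoid (Fin d)) : FockSpace d →L[ℂ] FockSpace d :=
  (α.toList.map S).prod

/-- The vector `∑ g, v g • e_{β g}`, i.e. `e_β ⊗ v` in the span of words with prefix `β`. -/
def blockVec {N : ℕ} (β : FreeMonoid (Fin 2)) (v : (Fin N → Fin 2) → ℂ) : FockSpace 2 :=
  ∑ g, v g • fockBasis 2 (β * FreeMonoid.ofList (List.ofFn g))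

theorem fockBasis_apply (d : ℕ) (α γ : FreeMonoid (Fin d)) :
    fockBasis d α γ = if γ = α then 1 else 0 := by
  by_cases h : γ = α
  · subst h; simp [fockBasis]
  · simp [fockBasis, h]

theorem norm_fockBasis (d : ℕ) (α : FreeMonoid (Fin d)) : ‖fockBasis d α‖ = 1 := by
  simp [fockBasis, lp.norm_single]

theorem blockVec_apply {N : ℕ} (β γ : FreeMonoid (Fin 2)) (v : (Fin N → Fin 2) → ℂ) :
    blockVec β v γ =
      ∑ g, if γ = β * FreeMonoid.ofList (List.ofFn g) then v g else 0 := by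
  have h : blockVec β v γ = ∑ g, (v g • fockBasis 2 (β * FreeMonoid.ofList (List.ofFn g))) γ := by
    rw [blockVec, lp.coeFn_sum, Finset.sum_apply]
  simp [h, fockBasis_apply]

theorem blockVec_apply_mul {N : ℕ} (β : FreeMonoid (Fin 2)) (v : (Fin N → Fin 2) → ℂ)
    (g : Fin N → Fin 2) : blockVec β v (β * FreeMonoid.ofList (List.ofFn g)) = v g := by
  simp [blockVec_apply, List.ofFn_injective.eq_iff]

theorem blockVec_apply_of_length_ne {N : ℕ} {β γ : FreeMonoid (Fin 2)}
    (h : β.length ≠ γ.length) (v : (Fin N → Fin 2) → ℂ) (g : Fin N → Fin 2) :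
    blockVec β v (γ * FreeMonoid.ofList (List.ofFn g)) = 0 := by
  rw [blockVec_apply]
  refine Finset.sum_eq_zero fun g' _ => if_neg fun e => h ?_
  have e' := congrArg FreeMonoid.length e
  simp only [FreeMonoid.length_mul] at e'
  simp only [FreeMonoid.length, FreeMonoid.toList_ofList, List.length_ofFn] at e' ⊢
  omega

theorem blockVec_single {N : ℕ} (β : FreeMonoid (Fin 2)) (g : Fin N → Fin 2) :
    blockVec β (Pi.single g 1) = fockBasis 2 (β * FreeMonoid.ofList (List.ofFn g)) := by
  simp [blockVec, Pi.single_apply]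

theorem blockVec_add {N : ℕ} (β : FreeMonoid (Fin 2)) (v w : (Fin N → Fin 2) → ℂ) :
    blockVec β (v + w) = blockVec β v + blockVec β w := by
  simp [blockVec, add_smul, Finset.sum_add_distrib]

theorem blockVec_smul {N : ℕ} (β : FreeMonoid (Fin 2)) (c : ℂ) (v : (Fin N → Fin 2) → ℂ) :
    blockVec β (c • v) = c • blockVec β v := by
  simp [blockVec, mul_smul, Finset.smul_sum]

theorem lift_apply_blockVec {N : ℕ} {ι : Type*} {a : ι → (FockSpace 2 →L[ℂ] FockSpace 2)}
    {M : ι → Matrix (Fin N → Fin 2) (Fin N → Fin 2) ℂ} {β : FreeMonoid (Fin 2)}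
    (h : ∀ i g, a i (fockBasis 2 (β * FreeMonoid.ofList (List.ofFn g))) =
      blockVec β fun g' => M i g' g)
    (f : FreeAlgebra ℂ ι) (v : (Fin N → Fin 2) → ℂ) :
    FreeAlgebra.lift ℂ a f (blockVec β v) =
      blockVec β ((FreeAlgebra.lift ℂ M f).mulVec v) := by
  induction f using FreeAlgebra.induction generalizing v with
  | grade0 r => simp [Algebra.algebraMap_eq_smul_one, Matrix.smul_mulVec, blockVec_smul]
  | grade1 i =>
    simp only [FreeAlgebra.lift_ι_apply]
    conv_lhs => rw [blockVec]
    simp only [map_sum, map_smul, h]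
    simp only [blockVec, Matrix.mulVec, dotProduct, Finset.smul_sum, Finset.sum_smul, smul_smul]
    rw [Finset.sum_comm]
    simp only [mul_comm]
  | mul x y hx hy => simp [hx, hy]
  | add x y hx hy => simp [hx, hy, Matrix.add_mulVec, blockVec_add]

theorem lift_apply_fockBasis {N : ℕ} {ι : Type*} {a : ι → (FockSpace 2 →L[ℂ] FockSpace 2)}
    {M : ι → Matrix (Fin N → Fin 2) (Fin N → Fin 2) ℂ} {β : FreeMonoid (Fin 2)}
    (h : ∀ i g, a i (fockBasis 2 (β * FreeMonoid.ofList (List.ofFn g))) =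
      blockVec β fun g' => M i g' g)
    (f : FreeAlgebra ℂ ι) (g : Fin N → Fin 2) :
    FreeAlgebra.lift ℂ a f (fockBasis 2 (β * FreeMonoid.ofList (List.ofFn g))) =
      blockVec β fun g' => FreeAlgebra.lift ℂ M f g' g := by
  rw [← blockVec_single, lift_apply_blockVec h]
  congr 1
  ext g'
  simp

theorem lift_zero_eq_algebraMap {R ι A : Type*} [CommRing R] [Ring A] [Algebra R A]
    (f : FreeAlgebra R ι) : FreeAlgebra.lift R (fun _ : ι => (0 : A)) f =
      algebraMap R A (FreeAlgebra.lift R (fun _ : ι => (0 : R)) f) := by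
  have : FreeAlgebra.lift R (fun _ : ι => (0 : A)) =
      (Algebra.ofId R A).comp (FreeAlgebra.lift R (fun _ : ι => (0 : R))) := by
    ext i
    simp
  rw [this]
  rfl

theorem isCompactOperator_of_apply_fockBasis_eq_zero {d : ℕ}
    (T : FockSpace d →L[ℂ] FockSpace d) (s : Finset (FreeMonoid (Fin d)))
    (h : ∀ α ∉ s, T (fockBasis d α) = 0) : IsCompactOperator T := by
  have hT : ∀ x : FockSpace d, T x = ∑ α ∈ s, x α • T (fockBasis d α) := by
    intro x
    have h1 := (lp.hasSum_single (by simp) x).mapL T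
    have h2 : ∀ α, T (lp.single 2 α (x α)) = x α • T (fockBasis d α) := by
      intro α
      rw [← map_smul, fockBasis, ← lp.single_smul, smul_eq_mul, mul_one]
    simp only [h2] at h1
    exact h1.unique (hasSum_sum_of_ne_finset_zero fun α hα => by rw [h α hα, smul_zero])
  let V : Submodule ℂ (FockSpace d) := Submodule.span ℂ ((fun α => T (fockBasis d α)) '' s)
  have : FiniteDimensional ℂ V :=
    FiniteDimensional.span_of_finite ℂ (s.finite_toSet.image _)
  have hV : ∀ x, T x ∈ V := fun x => by
    rw [hT]
    exact V.sum_mem fun α hα => V.smul_mem _ (Submodule.subset_span ⟨α, hα, rfl⟩)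
  have : ProperSpace V := FiniteDimensional.proper ℂ V
  exact (isCompactOperator_of_locallyCompactSpace_dom (T.codRestrict V hV)).clm_comp V.subtypeL

theorem eq_zero_of_isCompactOperator {N : ℕ} {T : FockSpace 2 →L[ℂ] FockSpace 2}
    (hT : IsCompactOperator T) {β : ℕ → FreeMonoid (Fin 2)}
    (hβ : Function.Injective fun n => (β n).length)
    {M : Matrix (Fin N → Fin 2) (Fin N → Fin 2) ℂ}
    (h : ∀ n g, T (fockBasis 2 (β n * FreeMonoid.ofList (List.ofFn g))) =
      blockVec (β n) fun g' => M g' g) : M = 0 := by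
  ext g' g
  by_contra hM
  obtain ⟨K, hK, hK'⟩ := hT.image_closedBall_subset_compact (𝕜₁ := ℂ) (f := T.toLinearMap) 1
  obtain ⟨y, -, φ, hφ, hy⟩ := hK.tendsto_subseq
    (x := fun n => T (fockBasis 2 (β n * FreeMonoid.ofList (List.ofFn g))))
    (fun n => hK' ⟨_, by simp [norm_fockBasis], rfl⟩)
  obtain ⟨n, hn⟩ := Metric.cauchySeq_iff'.1 hy.cauchySeq ‖M g' g‖ (norm_pos_iff.2 hM)
  have h1 := hn (n + 1) (Nat.le_succ n)
  rw [dist_eq_norm] at h1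
  refine absurd h1 (not_lt.2 ?_)
  simp only [Function.comp, h]
  refine le_trans (le_of_eq ?_)
    (lp.norm_apply_le_norm two_ne_zero _ (β (φ (n + 1)) * FreeMonoid.ofList (List.ofFn g')))
  rw [lp.coeFn_sub, Pi.sub_apply, blockVec_apply_mul, blockVec_apply_of_length_ne, sub_zero]
  exact fun e => absurd (hφ.injective (hβ e)) (by simp)

theorem exists_eq_mul_ofFn {N : ℕ} {α : FreeMonoid (Fin 2)} (h : N < α.length) :
    ∃ (i : Fin 2) (γ : FreeMonoid (Fin 2)) (g : Fin N → Fin 2),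
      α = FreeMonoid.of i * γ * FreeMonoid.ofList (List.ofFn g) := by
  induction α using FreeMonoid.casesOn with
  | one => simp at h
  | of_mul i δ =>
    have hδ : N ≤ δ.toList.length := by
      rw [FreeMonoid.length_mul, FreeMonoid.length_of] at h
      exact Nat.lt_one_add_iff.1 h
    refine ⟨i, FreeMonoid.ofList (δ.toList.take (δ.toList.length - N)),
      fun j => (δ.toList.drop (δ.toList.length - N)).get (j.cast (by simp; omega)), ?_⟩
    have : List.ofFn (fun j : Fin N => (δ.toList.drop (δ.toList.length - N)).get
        (j.cast (by simp; omega))) = δ.toList.drop (δ.toList.length - N) := by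
      apply List.ext_getElem
      · simp; omega
      · simp
    rw [this, mul_assoc, ← FreeMonoid.ofList_append, List.take_append_drop,
      FreeMonoid.ofList_toList]

theorem finite_setOf_length_le (N : ℕ) : {α : FreeMonoid (Fin 2) | α.length ≤ N}.Finite :=
  List.finite_length_le (Fin 2) N

theorem isCompactOperator_lift_iff {N : ℕ} {ι : Type*}
    {a : ι → (FockSpace 2 →L[ℂ] FockSpace 2)}
    {M M' : ι → Matrix (Fin N → Fin 2) (Fin N → Fin 2) ℂ}
    (hM : ∀ (γ : FreeMonoid (Fin 2)) i g, Even γ.length →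
      a i (fockBasis 2 (FreeMonoid.of 0 * γ * FreeMonoid.ofList (List.ofFn g))) =
        blockVec (FreeMonoid.of 0 * γ) fun g' => M i g' g)
    (hM' : ∀ (γ : FreeMonoid (Fin 2)) i g, ¬ Even γ.length →
      a i (fockBasis 2 (FreeMonoid.of 0 * γ * FreeMonoid.ofList (List.ofFn g))) =
        blockVec (FreeMonoid.of 0 * γ) fun g' => M' i g' g)
    (h0 : ∀ (γ : FreeMonoid (Fin 2)) i (g : Fin N → Fin 2),
      a i (fockBasis 2 (FreeMonoid.of 1 * γ * FreeMonoid.ofList (List.ofFn g))) = 0)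
    (f : FreeAlgebra ℂ ι) (hf : FreeAlgebra.lift ℂ (fun _ : ι => (0 : ℂ)) f = 0) :
    IsCompactOperator (FreeAlgebra.lift ℂ a f) ↔
      FreeAlgebra.lift ℂ M f = 0 ∧ FreeAlgebra.lift ℂ M' f = 0 := by
  constructor
  · intro hc
    constructor
    · refine eq_zero_of_isCompactOperator hc
        (β := fun n => FreeMonoid.of 0 * FreeMonoid.ofList (List.replicate (2 * n) 0)) ?_
        fun n g => lift_apply_fockBasis (fun i g => hM _ i g ?_) f g
      · intro m n hmn
        simpa [FreeMonoid.length] using hmn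
      · simp [FreeMonoid.length]
    · refine eq_zero_of_isCompactOperator hc
        (β := fun n => FreeMonoid.of 0 * FreeMonoid.ofList (List.replicate (2 * n + 1) 0)) ?_
        fun n g => lift_apply_fockBasis (fun i g => hM' _ i g ?_) f g
      · intro m n hmn
        simpa [FreeMonoid.length] using hmn
      · simp [FreeMonoid.length]
  · rintro ⟨hz, hz'⟩
    refine isCompactOperator_of_apply_fockBasis_eq_zero _
      (finite_setOf_length_le N).toFinset fun α hα => ?_
    obtain ⟨i, γ, g, rfl⟩ := exists_eq_mul_ofFn (N := N) (α := α) (by simpa using hα)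
    fin_cases i
    · by_cases hγ : Even γ.length
      · refine (lift_apply_fockBasis (fun i g => hM γ i g hγ) f g).trans ?_
        simp [hz, blockVec]
      · refine (lift_apply_fockBasis (fun i g => hM' γ i g hγ) f g).trans ?_
        simp [hz', blockVec]
    · refine (lift_apply_fockBasis (M := fun _ => 0)
        (fun i g => (h0 γ i g).trans (by simp [blockVec])) f g).trans ?_
      rw [lift_zero_eq_algebraMap, hf]
      simp [blockVec]

open ContinuousLinearMap in
theorem adjoint_apply_apply {T : FockSpace 2 →L[ℂ] FockSpace 2} {i : Fin 2}
    (hT : ∀ α, T (fockBasis 2 α) = fockBasis 2 (FreeMonoid.of i * α))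
    (x : FockSpace 2) (γ : FreeMonoid (Fin 2)) :
    adjoint T x γ = x (FreeMonoid.of i * γ) := by
  have h : ∀ (δ : FreeMonoid (Fin 2)) (y : FockSpace 2), y δ = inner ℂ (fockBasis 2 δ) y := by
    intro δ y
    simp [fockBasis, lp.inner_single_left]
  rw [h, adjoint_inner_right, hT, ← h]

open ContinuousLinearMap in
theorem adjoint_apply_fockBasis_of_mul {T : FockSpace 2 →L[ℂ] FockSpace 2} {i : Fin 2}
    (hT : ∀ α, T (fockBasis 2 α) = fockBasis 2 (FreeMonoid.of i * α))
    (j : Fin 2) (α : FreeMonoid (Fin 2)) :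
    adjoint T (fockBasis 2 (FreeMonoid.of j * α)) = if i = j then fockBasis 2 α else 0 := by
  ext γ
  rw [adjoint_apply_apply hT, fockBasis_apply]
  have hiff : FreeMonoid.of i * γ = FreeMonoid.of j * α ↔ i = j ∧ γ = α := List.cons_eq_cons
  by_cases hij : i = j <;> simp [hiff, hij, fockBasis_apply]

open scoped ComplexOrder in
open ContinuousLinearMap in
theorem statement18 (N : ℕ) (hN : 1 ≤ N)
    (S : Fin 2 → (FockSpace 2 →L[ℂ] FockSpace 2))
    (hS : ∀ (i : Fin 2) (α : FreeMonoid (Fin 2)),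
      S i (fockBasis 2 α) = fockBasis 2 (FreeMonoid.of i * α))
    (P : ℕ → (FockSpace 2 →L[ℂ] FockSpace 2))
    (hP : ∀ (k : ℕ) (α : FreeMonoid (Fin 2)),
      P k (fockBasis 2 α) = if α.length = k then fockBasis 2 α else 0)
    (A B : Matrix (Fin N → Fin 2) (Fin N → Fin 2) ℂ)
    (hA : A.PosDef) (hB : B.PosDef)
    (Z : FockSpace 2 →L[ℂ] FockSpace 2)
    (hZinv : IsUnit Z)
    (hZP : ∀ k : ℕ, Z * P k = P k * Z)
    (hZshort : ∀ α : FreeMonoid (Fin 2), α.length < N → Z (fockBasis 2 α) = fockBasis 2 α)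
    (hZA : ∀ (β : FreeMonoid (Fin 2)) (g : Fin N → Fin 2), Even β.length →
      Z (fockBasis 2 (β * FreeMonoid.ofList (List.ofFn g))) =
        ∑ g' : Fin N → Fin 2, A g' g • fockBasis 2 (β * FreeMonoid.ofList (List.ofFn g')))
    (hZB : ∀ (β : FreeMonoid (Fin 2)) (g : Fin N → Fin 2), ¬ Even β.length →
      Z (fockBasis 2 (β * FreeMonoid.ofList (List.ofFn g))) =
        ∑ g' : Fin N → Fin 2, B g' g • fockBasis 2 (β * FreeMonoid.ofList (List.ofFn g')))
    (f : FreeAlgebra ℂ (Fin 3))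
    (hf : (FreeAlgebra.lift ℂ (fun _ : Fin 3 => (0 : ℂ))) f = 0)
    (S1 : FockSpace 2 →L[ℂ] FockSpace 2) (hS1 : S1 = S 0) :
    (((FreeAlgebra.lift ℂ ![A, B, 1]) f = 0 ∧ (FreeAlgebra.lift ℂ ![B, A, 1]) f = 0) ↔
      IsCompactOperator
        ⇑((FreeAlgebra.lift ℂ ![S1 * adjoint S1 * Z, S1 * Z * adjoint S1, S1 * adjoint S1]) f)) ∧
    (((FreeAlgebra.lift ℂ ![A, B, 1]) f = 0 ∧ (FreeAlgebra.lift ℂ ![B, A, 1]) f = 0) ↔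
      IsCompactOperator
        ⇑((FreeAlgebra.lift ℂ ![S1 * Z * adjoint S1, S1 * adjoint S1 * Z, S1 * adjoint S1]) f)) := by
  subst hS1
  have hadj := adjoint_apply_fockBasis_of_mul (hS 0)
  have hE1 : ∀ (γ : FreeMonoid (Fin 2)),
      adjoint (S 0) (fockBasis 2 (FreeMonoid.of 1 * γ)) = 0 := fun γ => by
    rw [hadj, if_neg (by decide)]
  have hE0 : ∀ (γ : FreeMonoid (Fin 2)),
      adjoint (S 0) (fockBasis 2 (FreeMonoid.of 0 * γ)) = fockBasis 2 γ := fun γ => by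
    rw [hadj, if_pos rfl]
  have hlen : ∀ (i : Fin 2) (γ : FreeMonoid (Fin 2)),
      Even (FreeMonoid.of i * γ).length ↔ ¬ Even γ.length := fun i γ => by
    rw [FreeMonoid.length_mul, FreeMonoid.length_of, add_comm, Nat.even_add_one]
  have hZapply : ∀ (β : FreeMonoid (Fin 2)) (g : Fin N → Fin 2),
      Z (fockBasis 2 (β * FreeMonoid.ofList (List.ofFn g))) =
        blockVec β fun g' => (if Even β.length then A else B) g' g := by
    intro β g
    split_ifs with h
    · exact hZA β g h
    · exact hZB β g h
  have hSvec : ∀ (γ : FreeMonoid (Fin 2)) (v : (Fin N → Fin 2) → ℂ),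
      S 0 (blockVec γ v) = blockVec (FreeMonoid.of 0 * γ) v := by
    intro γ v
    simp [blockVec, hS, mul_assoc]
  have hadj0 : ∀ (γ : FreeMonoid (Fin 2)) (v : (Fin N → Fin 2) → ℂ),
      adjoint (S 0) (blockVec (FreeMonoid.of 0 * γ) v) = blockVec γ v := by
    intro γ v
    simp [blockVec, hE0, mul_assoc]
  have hadj1 : ∀ (γ : FreeMonoid (Fin 2)) (v : (Fin N → Fin 2) → ℂ),
      adjoint (S 0) (blockVec (FreeMonoid.of 1 * γ) v) = 0 := by
    intro γ v
    simp [blockVec, hE1, mul_assoc]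
  have hEZ : ∀ (γ : FreeMonoid (Fin 2)) (g : Fin N → Fin 2), (S 0 * adjoint (S 0) * Z)
      (fockBasis 2 (FreeMonoid.of 0 * γ * FreeMonoid.ofList (List.ofFn g))) =
        blockVec (FreeMonoid.of 0 * γ) fun g' => (if Even γ.length then B else A) g' g := by
    intro γ g
    simp only [mul_def, comp_apply, hZapply, hadj0, hSvec, hlen, ite_not]
  have hSZS : ∀ (γ : FreeMonoid (Fin 2)) (g : Fin N → Fin 2), (S 0 * Z * adjoint (S 0))
      (fockBasis 2 (FreeMonoid.of 0 * γ * FreeMonoid.ofList (List.ofFn g))) =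
        blockVec (FreeMonoid.of 0 * γ) fun g' => (if Even γ.length then A else B) g' g := by
    intro γ g
    rw [mul_assoc (FreeMonoid.of 0)]
    simp only [mul_def, comp_apply, hE0, hZapply, hSvec]
  have hE : ∀ (γ : FreeMonoid (Fin 2)) (g : Fin N → Fin 2), (S 0 * adjoint (S 0))
      (fockBasis 2 (FreeMonoid.of 0 * γ * FreeMonoid.ofList (List.ofFn g))) =
        blockVec (FreeMonoid.of 0 * γ) fun g' =>
          (1 : Matrix (Fin N → Fin 2) (Fin N → Fin 2) ℂ) g' g := by
    intro γ g
    have h1 : (fun g' => (1 : Matrix (Fin N → Fin 2) (Fin N → Fin 2) ℂ) g' g) =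
        Pi.single g 1 := by
      ext g'
      simp [Matrix.one_apply, Pi.single_apply]
    rw [h1, blockVec_single, mul_assoc (FreeMonoid.of 0), mul_def, comp_apply, hE0, hS]
  have hEZ1 : ∀ (γ : FreeMonoid (Fin 2)) (g : Fin N → Fin 2), (S 0 * adjoint (S 0) * Z)
      (fockBasis 2 (FreeMonoid.of 1 * γ * FreeMonoid.ofList (List.ofFn g))) = 0 := by
    intro γ g
    simp only [mul_def, comp_apply, hZapply, hadj1, map_zero]
  have hSZS1 : ∀ (γ : FreeMonoid (Fin 2)) (g : Fin N → Fin 2), (S 0 * Z * adjoint (S 0))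
      (fockBasis 2 (FreeMonoid.of 1 * γ * FreeMonoid.ofList (List.ofFn g))) = 0 := by
    intro γ g
    rw [mul_assoc (FreeMonoid.of 1)]
    simp only [mul_def, comp_apply, hE1, map_zero]
  have hEE1 : ∀ (γ : FreeMonoid (Fin 2)) (g : Fin N → Fin 2), (S 0 * adjoint (S 0))
      (fockBasis 2 (FreeMonoid.of 1 * γ * FreeMonoid.ofList (List.ofFn g))) = 0 := by
    intro γ g
    rw [mul_assoc (FreeMonoid.of 1)]
    simp only [mul_def, comp_apply, hE1, map_zero]
  constructor
  · rw [and_comm]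
    refine (isCompactOperator_lift_iff (fun γ i g hγ => ?_) (fun γ i g hγ => ?_)
      (fun γ i g => ?_) f hf).symm
    · fin_cases i
      · exact (hEZ γ g).trans (by rw [if_pos hγ]; rfl)
      · exact (hSZS γ g).trans (by rw [if_pos hγ]; rfl)
      · exact hE γ g
    · fin_cases i
      · exact (hEZ γ g).trans (by rw [if_neg hγ]; rfl)
      · exact (hSZS γ g).trans (by rw [if_neg hγ]; rfl)
      · exact hE γ g
    · fin_cases i
      exacts [hEZ1 γ g, hSZS1 γ g, hEE1 γ g]
  · refine (isCompactOperator_lift_iff (fun γ i g hγ => ?_) (fun γ i g hγ => ?_)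
      (fun γ i g => ?_) f hf).symm
    · fin_cases i
      · exact (hSZS γ g).trans (by rw [if_pos hγ]; rfl)
      · exact (hEZ γ g).trans (by rw [if_pos hγ]; rfl)
      · exact hE γ g
    · fin_cases i
      · exact (hSZS γ g).trans (by rw [if_neg hγ]; rfl)
      · exact (hEZ γ g).trans (by rw [if_neg hγ]; rfl)
      · exact hE γ g
    · fin_cases i
      exacts [hSZS1 γ g, hEZ1 γ g, hEE1 γ g]
end
end
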